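/- Assuming CH, there is a weakly tight MAD family on ω^{<ω} that is not +-Ramsey. -/

import Mathlib

variable {α : Type}

/-- An almost disjoint family on a countable set `α`. -/
def IsADF (𝒜 : Set (Set α)) : Prop :=
  (∀ A ∈ 𝒜, A.Infinite) ∧ ∀ A ∈ 𝒜, ∀ B ∈ 𝒜, A ≠ B → (A ∩ B).Finite

/-- A maximal almost disjoint family on `α`. -/
def IsMAD (𝒜 : Set (Set α)) : Prop :=
  IsADF 𝒜 ∧ ∀ X : Set α, X.Infinite → ∃ A ∈ 𝒜, (X ∩ A).Infinite

/-- `X ∈ I(𝒜)`: the ideal generated by `𝒜` together with the finite sets. -/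
def InIdeal (𝒜 : Set (Set α)) (X : Set α) : Prop :=
  ∃ F : Finset (Set α), ↑F ⊆ 𝒜 ∧ (X \ ⋃ A ∈ F, A).Finite

/-- `X` is `I(𝒜)`-positive. -/
def Positive (𝒜 : Set (Set α)) (X : Set α) : Prop := ¬ InIdeal 𝒜 X

/-- A tree of finite sequences from `α`, closed under initial segments. -/
def IsTree (T : Set (List α)) : Prop := ∀ s ∈ T, ∀ t, t <+: s → t ∈ T

/-- The successor set `suc_T(s)`. -/
def sucT (T : Set (List α)) (s : List α) : Set α := {a | s ++ [a] ∈ T}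

/-- `𝒜` is `+`-Ramsey: every tree all of whose successor sets are `I(𝒜)`-positive
has a branch whose range is `I(𝒜)`-positive. -/
def PlusRamsey (𝒜 : Set (Set α)) : Prop :=
  ∀ T : Set (List α), [] ∈ T → IsTree T → (∀ s ∈ T, Positive 𝒜 (sucT T s)) →
    ∃ f : ℕ → α, (∀ n, (List.range n).map f ∈ T) ∧ Positive 𝒜 (Set.range f)

/-- `𝒜` is weakly tight: for every countable family of `I(𝒜)`-positive sets there is
`B ∈ I(𝒜)` meeting infinitely many of them infinitely. -/
def WeaklyTight (𝒜 : Set (Set (List ℕ))) : Prop :=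
  ∀ X : ℕ → Set (List ℕ), (∀ n, Positive 𝒜 (X n)) →
    ∃ B : Set (List ℕ), InIdeal 𝒜 B ∧ {n | (B ∩ X n).Infinite}.Infinite

open Set Filter

/-- The set of finite initial segments of `f`. -/
def branch (f : ℕ → ℕ) : Set (List ℕ) := range fun n => (List.range n).map f

theorem eq_map_range_of_mem_branch {f : ℕ → ℕ} {x : List ℕ} (hx : x ∈ branch f) :
    x = (List.range x.length).map f := by
  obtain ⟨n, rfl⟩ := hx
  simp

theorem branch_infinite (f : ℕ → ℕ) : (branch f).Infinite := by
  refine infinite_range_of_injective fun m n h => ?_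
  simpa using congrArg List.length h

theorem branch_inter_branch_finite {f g : ℕ → ℕ} (h : f ≠ g) :
    (branch f ∩ branch g).Finite := by
  obtain ⟨k, hk⟩ := Function.ne_iff.1 h
  refine ((finite_Iic k).image fun n => (List.range n).map f).subset ?_
  rintro x ⟨hf, hg⟩
  have hf' := eq_map_range_of_mem_branch hf
  have hg' := eq_map_range_of_mem_branch hg
  refine ⟨x.length, ?_, hf'.symm⟩
  by_contra hlt
  have hlt : k < x.length := by simpa using hlt
  apply hk
  have h1 := hf'.symm.trans hg'
  exact List.map_inj_left.1 h1 k (List.mem_range.2 hlt)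

theorem chain_subset_branch {C : Set (List ℕ)} (h : ∀ x ∈ C, ∀ y ∈ C, x <+: y ∨ y <+: x) :
    ∃ f, C ⊆ branch f := by
  classical
  refine ⟨fun n => if hn : ∃ x ∈ C, n < x.length then hn.choose.getD n 0 else 0, ?_⟩
  intro x hx
  refine ⟨x.length, ?_⟩
  apply List.ext_getElem
  · simp
  · intro i h1 h2
    have hn : ∃ x ∈ C, i < x.length := ⟨x, hx, h2⟩
    simp only [List.getElem_map, List.getElem_range, dif_pos hn]
    obtain ⟨hy, hi⟩ := hn.choose_spec
    rw [List.getD_eq_getElem _ _ hi]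
    rcases h x hx _ hy with hp | hp
    · exact (hp.getElem h2).symm
    · exact hp.getElem hi

theorem finite_prefixes (x : List ℕ) : {y : List ℕ | y <+: x}.Finite := by
  refine (x.inits.finite_toSet).subset fun y hy => ?_
  simpa using hy

/-- The nodes whose cone belongs to the ultrafilter `V`. -/
def spine (V : Ultrafilter (List ℕ)) : Set (List ℕ) := {x | {y | x <+: y} ∈ V}

theorem mem_spine_of_prefix_of_mem {V : Ultrafilter (List ℕ)} {x y : List ℕ} (h : x <+: y)
    (hy : y ∈ spine V) : x ∈ spine V :=
  mem_of_superset hy fun _ hz => h.trans hz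

theorem spine_chain {V : Ultrafilter (List ℕ)} {x y : List ℕ} (hx : x ∈ spine V)
    (hy : y ∈ spine V) : x <+: y ∨ y <+: x := by
  obtain ⟨z, hxz, hyz⟩ := V.nonempty_of_mem (inter_mem hx hy)
  exact (le_total x.length y.length).imp (List.prefix_of_prefix_length_le hxz hyz)
    (List.prefix_of_prefix_length_le hyz hxz)

theorem spine_notMem {V W : Ultrafilter (List ℕ)} (hW : ∀ f, branch f ∉ W) : spine V ∉ W := by
  obtain ⟨f, hf⟩ := chain_subset_branch fun x hx y hy => spine_chain (V := V) hx hy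
  exact fun h => hW f (mem_of_superset h hf)

theorem finite_notMem {V : Ultrafilter (List ℕ)} (hV : ∀ f, branch f ∉ V)
    {s : Set (List ℕ)} (hs : s.Finite) : s ∉ V := by
  intro h
  obtain ⟨x, -, rfl⟩ := V.eq_pure_of_finite_mem hs h
  exact hV (fun n => x.getD n 0) (Ultrafilter.mem_pure.2 ⟨x.length, by
    apply List.ext_getElem <;> simp +contextual⟩)

theorem incomparable_mem {V : Ultrafilter (List ℕ)} (hV : ∀ f, branch f ∉ V) {x : List ℕ}
    (hx : x ∉ spine V) : {y | ¬ x <+: y ∧ ¬ y <+: x} ∈ V :=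
  inter_mem (Ultrafilter.compl_mem_iff_notMem.2 hx)
    (Ultrafilter.compl_mem_iff_notMem.2 (finite_notMem hV (finite_prefixes x)))

/-- A sequence of ultrafilters concentrating on no branch has a subsequence whose members
contain the complement of all the spines along it. -/
theorem exists_subseq_iUnion_spine_notMem (V : ℕ → Ultrafilter (List ℕ))
    (hV : ∀ n f, branch f ∉ V n) :
    ∃ ν : ℕ → ℕ, ν.Injective ∧ ∀ m, (⋃ n, spine (V (ν n))) ∉ V (ν m) := by
  classical
  obtain ⟨c, φ, hφ, hlim⟩ :=
    SeqCompactSpace.tendsto_subseq fun n (x : List ℕ) => decide (x ∈ spine (V n))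
  have hc : ∀ x, ∀ᶠ n in atTop, (x ∈ spine (V (φ n)) ↔ c x = true) := by
    intro x
    have h1 := (tendsto_pi_nhds.1 hlim x)
    rw [nhds_discrete, tendsto_pure] at h1
    filter_upwards [h1] with n hn
    rw [← hn]
    simp
  by_cases hM : {m | spine (V (φ m)) = {x | c x = true}}.Infinite
  · refine ⟨fun n => φ (Nat.nth (· ∈ {m | spine (V (φ m)) = {x | c x = true}}) n),
      hφ.injective.comp (Nat.nth_injective hM), fun m => ?_⟩
    have h1 : ∀ n, spine (V (φ (Nat.nth (· ∈ {m | spine (V (φ m)) = {x | c x = true}}) n)))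
        = {x | c x = true} := fun n => Nat.nth_mem_of_infinite hM n
    have h2 := spine_notMem (V := V (φ (Nat.nth
      (· ∈ {m | spine (V (φ m)) = {x | c x = true}}) m))) (hV (φ (Nat.nth
      (· ∈ {m | spine (V (φ m)) = {x | c x = true}}) m)))
    simp only [h1] at h2 ⊢
    rwa [iUnion_const]
  have hM' : {m | spine (V (φ m)) ≠ {x | c x = true}}.Infinite :=
    (not_infinite.1 hM).infinite_compl
  have key : ∀ m, spine (V (φ m)) ≠ {x | c x = true} → (⋃ n, spine (V (φ n))) ∉ V (φ m) := by
    intro m hm hmem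
    have fin : ∀ N, (⋃ n ∈ Iio N, spine (V (φ n))) ∉ V (φ m) := by
      intro N h
      obtain ⟨i, -, hi⟩ := (Ultrafilter.finite_biUnion_mem_iff (finite_Iio N)).1 h
      exact spine_notMem (hV _) hi
    obtain ⟨x, hx⟩ : ∃ x, ¬ (x ∈ spine (V (φ m)) ↔ c x = true) := by
      by_contra! h
      exact hm (Set.ext h)
    obtain ⟨N, hN⟩ := eventually_atTop.1 (hc x)
    by_cases hxm : x ∈ spine (V (φ m))
    · refine fin N (mem_of_superset (inter_mem hmem hxm) ?_)
      rintro y ⟨hy, hxy⟩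
      obtain ⟨n, hn⟩ := mem_iUnion.1 hy
      refine mem_biUnion (x := n) ?_ hn
      by_contra hlt
      have h1 := (hN n (by simpa using hlt)).1 (mem_spine_of_prefix_of_mem hxy hn)
      exact hx ⟨fun _ => h1, fun _ => hxm⟩
    · have hcx : c x = true := by
        by_contra h
        exact hx ⟨fun h' => absurd h' hxm, fun h' => absurd h' h⟩
      refine fin N (mem_of_superset (inter_mem hmem (incomparable_mem (hV _) hxm)) ?_)
      rintro y ⟨hy, hxy⟩
      obtain ⟨n, hn⟩ := mem_iUnion.1 hy
      refine mem_biUnion (x := n) ?_ hn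
      by_contra hlt
      have h1 := (hN n (by simpa using hlt)).2 hcx
      rcases spine_chain h1 hn with h | h
      · exact hxy.1 h
      · exact hxy.2 h
  refine ⟨fun n => φ (Nat.nth (· ∈ {m | spine (V (φ m)) ≠ {x | c x = true}}) n),
    hφ.injective.comp (Nat.nth_injective hM'), fun m hm => ?_⟩
  refine key _ (Nat.nth_mem_of_infinite hM' m) (mem_of_superset hm ?_)
  exact iUnion_subset fun n => subset_iUnion (fun n => spine (V (φ n))) _

theorem exists_seq_of_finset {β : Type*} (Q : ℕ → Finset β → β → Prop)
    (h : ∀ j s, ∃ y, Q j s y) : ∃ u : ℕ → β, ∀ j, ∃ s, (∀ i < j, u i ∈ s) ∧ Q j s (u j) := by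
  classical
  choose g hg using h
  let F : ℕ → Finset β := fun n => Nat.rec ∅ (fun j s => insert (g j s) s) n
  have hF : ∀ j, F (j + 1) = insert (g j (F j)) (F j) := fun j => rfl
  refine ⟨fun j => g j (F j), fun j => ⟨F j, fun i hi => ?_, hg _ _⟩⟩
  induction j, hi using Nat.le_induction with
  | base => simp [hF]
  | succ j _ ih => rw [hF]; exact Finset.mem_insert_of_mem ih

theorem InIdeal.mono {α : Type} {𝒜 ℬ : Set (Set α)} (h : 𝒜 ⊆ ℬ) {X : Set α}
    (hX : InIdeal 𝒜 X) : InIdeal ℬ X := by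
  obtain ⟨F, hF, hX⟩ := hX
  exact ⟨F, hF.trans h, hX⟩

theorem InIdeal.subset {α : Type} {𝒜 : Set (Set α)} {X Y : Set α} (h : Y ⊆ X)
    (hX : InIdeal 𝒜 X) : InIdeal 𝒜 Y := by
  obtain ⟨F, hF, hX⟩ := hX
  exact ⟨F, hF, hX.subset (sdiff_subset_sdiff_left h)⟩

theorem InIdeal.union {α : Type} {𝒜 : Set (Set α)} {X Y : Set α}
    (hX : InIdeal 𝒜 X) (hY : InIdeal 𝒜 Y) : InIdeal 𝒜 (X ∪ Y) := by
  classical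
  obtain ⟨F, hF, hX⟩ := hX
  obtain ⟨G, hG, hY⟩ := hY
  refine ⟨F ∪ G, by simp [hF, hG], (hX.union hY).subset ?_⟩
  rintro x ⟨hx, hn⟩
  simp only [mem_iUnion, Finset.mem_union, not_exists] at hn
  rcases hx with hx | hx
  · exact Or.inl ⟨hx, by simpa using fun A hA => hn A (Or.inl hA)⟩
  · exact Or.inr ⟨hx, by simpa using fun A hA => hn A (Or.inr hA)⟩

theorem inIdeal_of_finite {α : Type} {𝒜 : Set (Set α)} {X : Set α} (hX : X.Finite) :
    InIdeal 𝒜 X :=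
  ⟨∅, by simp, hX.subset sdiff_subset⟩

theorem inIdeal_of_mem {α : Type} {𝒜 : Set (Set α)} {A : Set α} (hA : A ∈ 𝒜) :
    InIdeal 𝒜 A :=
  ⟨{A}, by simpa using hA, by simp⟩

/-- A positive set belongs to an ultrafilter disjoint from the ideal. -/
theorem Positive.exists_ultrafilter {α : Type} {𝒜 : Set (Set α)} {X : Set α}
    (hX : Positive 𝒜 X) : ∃ V : Ultrafilter α, X ∈ V ∧ ∀ A, InIdeal 𝒜 A → A ∉ V := by
  let 𝓕 : Filter α :=
    { sets := {S | InIdeal 𝒜 (X \ S)}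
      univ_sets := inIdeal_of_finite (by simp)
      sets_of_superset := fun hS hST => InIdeal.subset (sdiff_subset_sdiff_right hST) hS
      inter_sets := fun hS hT => by
        have := InIdeal.union hS hT
        rwa [← sdiff_inter] at this }
  have mem : ∀ S, S ∈ 𝓕 ↔ InIdeal 𝒜 (X \ S) := fun S => Iff.rfl
  have : 𝓕.NeBot := by
    rw [← empty_mem_iff_bot.not.trans neBot_iff.symm, mem, sdiff_empty]
    exact hX
  refine ⟨Ultrafilter.of 𝓕, Ultrafilter.of_le 𝓕 ((mem _).2 ?_), fun A hA => ?_⟩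
  · exact inIdeal_of_finite (by simp)
  · refine Ultrafilter.compl_mem_iff_notMem.1 (Ultrafilter.of_le 𝓕 ((mem _).2 ?_))
    exact hA.subset (by intro x hx; simpa using hx.2)

theorem exists_offBranch_set {𝒟 : Set (Set (List ℕ))} (h𝒟 : 𝒟.Countable)
    {X : ℕ → Set (List ℕ)} (hX : ∀ n, Positive (range branch ∪ 𝒟) (X n)) :
    ∃ D : Set (List ℕ), D.Infinite ∧ (∀ A ∈ range branch ∪ 𝒟, (D ∩ A).Finite) ∧
      {n | (D ∩ X n).Infinite}.Infinite := by
  classical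
  choose V hXV hV using fun n => (hX n).exists_ultrafilter
  have hbr : ∀ n f, branch f ∉ V n := fun n f =>
    hV n _ (inIdeal_of_mem (Or.inl (mem_range_self f)))
  obtain ⟨ν, hν, hspine⟩ := exists_subseq_iUnion_spine_notMem V hbr
  obtain ⟨A, hA⟩ : ∃ A : ℕ → Set (List ℕ), insert ∅ 𝒟 = range A :=
    (h𝒟.insert ∅).exists_eq_range (insert_nonempty _ _)
  have hAV : ∀ i n, A i ∉ V n := by
    intro i n
    have : A i ∈ insert ∅ 𝒟 := hA ▸ mem_range_self i
    rcases this with h | h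
    · rw [h]; exact (V n).empty_notMem
    · exact hV n _ (inIdeal_of_mem (Or.inr h))
  let Z := ⋃ n, spine (V (ν n))
  obtain ⟨u, hu⟩ := exists_seq_of_finset (β := List ℕ) (fun j s y =>
    y ∈ X (ν j.unpair.1) ∧ y ∉ Z ∧ (∀ i < j, y ∉ A i) ∧
      ∀ x ∈ s, x ∉ Z → (¬ x <+: y ∧ ¬ y <+: x)) (by
    intro j s
    have h1 : {y | ∀ i ∈ Finset.range j, y ∉ A i} ∈ V (ν j.unpair.1) := by
      rw [← Ultrafilter.mem_coe]
      exact (eventually_all_finset _).2 fun i _ => Ultrafilter.compl_mem_iff_notMem.2 (hAV i _)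
    have h2 : {y | ∀ x ∈ s, x ∉ Z → (¬ x <+: y ∧ ¬ y <+: x)} ∈ V (ν j.unpair.1) := by
      rw [← Ultrafilter.mem_coe]
      refine (eventually_all_finset _).2 fun x _ => ?_
      by_cases hx : x ∈ Z
      · simp [hx]
      · have hx' : x ∉ spine (V (ν j.unpair.1)) := fun h => hx (mem_iUnion.2 ⟨_, h⟩)
        filter_upwards [incomparable_mem (hbr _) hx'] with y hy _ using hy
    obtain ⟨y, ⟨⟨hy1, hy2⟩, hy3⟩, hy4⟩ := (V (ν j.unpair.1)).nonempty_of_mem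
      (inter_mem (inter_mem (inter_mem (hXV _)
        (Ultrafilter.compl_mem_iff_notMem.2 (hspine _))) h1) h2)
    exact ⟨y, hy1, hy2, fun i hi => hy3 i (Finset.mem_range.2 hi), hy4⟩)
  have huX : ∀ j, u j ∈ X (ν j.unpair.1) := fun j => (hu j).choose_spec.2.1
  have huA : ∀ j, ∀ i < j, u j ∉ A i := fun j => (hu j).choose_spec.2.2.2.1
  have huZ : ∀ j, u j ∉ Z := fun j => (hu j).choose_spec.2.2.1
  have hlt : ∀ i j, i < j → ¬ u i <+: u j ∧ ¬ u j <+: u i := by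
    intro i j hij
    obtain ⟨s, hs, -, -, -, h⟩ := hu j
    exact h _ (hs i hij) (huZ i)
  have hpre : ∀ i j, u i <+: u j → i = j := by
    intro i j h
    rcases lt_trichotomy i j with hij | hij | hij
    · exact absurd h (hlt _ _ hij).1
    · exact hij
    · exact absurd h (hlt _ _ hij).2
  have hinj : u.Injective := fun i j h => hpre i j (h ▸ List.prefix_rfl)
  refine ⟨range u, infinite_range_of_injective hinj, ?_, ?_⟩
  · rintro B (⟨f, rfl⟩ | hB)
    · refine Set.Subsingleton.finite ?_
      rintro _ ⟨⟨i, rfl⟩, k, hk⟩ _ ⟨⟨j, rfl⟩, l, hl⟩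
      have mono : ∀ {k l : ℕ}, k ≤ l → (List.range k).map f <+: (List.range l).map f := by
        intro k l h
        obtain ⟨d, rfl⟩ := Nat.exists_eq_add_of_le h
        rw [List.range_add, List.map_append]
        exact List.prefix_append _ _
      rcases le_total k l with h | h
      · exact congrArg u (hpre i j (by rw [← hk, ← hl]; exact mono h))
      · exact congrArg u (hpre j i (by rw [← hk, ← hl]; exact mono h)).symm
    · obtain ⟨i, rfl⟩ : B ∈ range A := hA ▸ mem_insert_of_mem _ hB
      refine ((finite_Iic i).image u).subset ?_
      rintro _ ⟨⟨j, rfl⟩, hj⟩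
      refine ⟨j, ?_, rfl⟩
      by_contra h
      exact huA j i (by simpa using h) hj
  · refine (infinite_range_of_injective hν).mono ?_
    rintro _ ⟨n, rfl⟩
    have : (range fun k => u (Nat.pair n k)).Infinite :=
      infinite_range_of_injective fun k l h => by
        simpa using hinj h
    refine this.mono ?_
    rintro _ ⟨k, rfl⟩
    exact ⟨mem_range_self _, by simpa using huX (Nat.pair n k)⟩

/-- Weakly tight almost disjoint families are maximal. -/
theorem IsADF.isMAD_of_weaklyTight {𝒜 : Set (Set (List ℕ))} (h : IsADF 𝒜)
    (hw : WeaklyTight 𝒜) : IsMAD 𝒜 := by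
  refine ⟨h, fun X hX => ?_⟩
  by_contra! hfin
  have hfin' : ∀ F : Finset (Set (List ℕ)), ↑F ⊆ 𝒜 → (X ∩ ⋃ A ∈ F, A).Finite := by
    intro F hF
    rw [inter_iUnion₂]
    exact F.finite_toSet.biUnion fun A hA => hfin A (hF hA)
  obtain ⟨B, ⟨F, hF, hB⟩, hinf⟩ := hw (fun _ => X) (by
    rintro - ⟨F, hF, hXF⟩
    refine hX (((hfin' F hF).union hXF).subset fun x hx => ?_)
    by_cases h : x ∈ ⋃ A ∈ F, A
    · exact Or.inl ⟨hx, h⟩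
    · exact Or.inr ⟨hx, h⟩)
  obtain ⟨n, hn⟩ := hinf.nonempty
  refine hn (((hfin' F hF).union hB).subset fun x hx => ?_)
  by_cases h : x ∈ ⋃ A ∈ F, A
  · exact Or.inl ⟨hx.2, h⟩
  · exact Or.inr ⟨hx.1, h⟩

/-- A set containing infinitely many members of an almost disjoint family is positive. -/
theorem IsADF.positive_of_infinite {α : Type} {𝒜 : Set (Set α)} (h : IsADF 𝒜) {X : Set α}
    (hX : {A ∈ 𝒜 | A ⊆ X}.Infinite) : Positive 𝒜 X := by
  rintro ⟨F, hF, hfin⟩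
  obtain ⟨A, ⟨hA, hAX⟩, hAF⟩ := hX.exists_notMem_finset F
  have h1 : (A ∩ ⋃ B ∈ F, B).Finite := by
    rw [inter_iUnion₂]
    exact F.finite_toSet.biUnion fun B hB =>
      h.2 A hA B (hF hB) fun hAB => hAF (hAB ▸ hB)
  refine h.1 A hA ((h1.union hfin).subset fun x hx => ?_)
  by_cases h : x ∈ ⋃ B ∈ F, B
  · exact Or.inl ⟨hx, h⟩
  · exact Or.inr ⟨hAX hx, h⟩

/-- An infinite set of immediate successors of `s`; for fixed `s` these are disjoint. -/
def succPiece (p : List ℕ × ℕ) : Set (List ℕ) := range fun m => p.1 ++ [Nat.pair p.2 m]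

theorem succPiece_infinite (p : List ℕ × ℕ) : (succPiece p).Infinite :=
  infinite_range_of_injective fun m n h => by simpa using h

theorem succPiece_disjoint {p q : List ℕ × ℕ} (h : p ≠ q) :
    succPiece p ∩ succPiece q = ∅ := by
  refine eq_empty_of_forall_notMem ?_
  rintro _ ⟨⟨m, rfl⟩, n, hn⟩
  obtain ⟨h1, h2⟩ := List.append_inj' hn rfl
  simp only [List.cons.injEq, Nat.pair_eq_pair, and_true] at h2
  exact h (Prod.ext h1.symm h2.1.symm)

theorem succPiece_injective : succPiece.Injective := by
  intro p q h
  by_contra hne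
  have := succPiece_disjoint hne
  rw [← h, inter_self] at this
  exact (succPiece_infinite p).nonempty.ne_empty this

theorem succPiece_inter_branch_finite (p : List ℕ × ℕ) (f : ℕ → ℕ) :
    (succPiece p ∩ branch f).Finite := by
  refine (finite_singleton ((List.range (p.1.length + 1)).map f)).subset ?_
  rintro _ ⟨⟨m, rfl⟩, h⟩
  have := eq_map_range_of_mem_branch h
  simpa using this

/-- If the immediate successor sets are positive and all branches are in the ideal, the tree
of initial parts of branches witnesses that `𝒜` is not `+`-Ramsey. -/
theorem not_plusRamsey {𝒜 : Set (Set (List ℕ))} (hbr : ∀ f, branch f ∈ 𝒜)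
    (hsucc : ∀ s : List ℕ, Positive 𝒜 (range fun k => s ++ [k])) : ¬ PlusRamsey 𝒜 := by
  intro h
  obtain ⟨g, hg, hpos⟩ := h
    {l | ∃ f : ℕ → ℕ, l = (List.range l.length).map fun i => (List.range (i + 1)).map f}
    ⟨fun _ => 0, rfl⟩ (by
      rintro s ⟨f, hs⟩ t ht
      refine ⟨f, ?_⟩
      have h1 : t = s.take t.length := List.prefix_iff_eq_take.1 ht
      have h2 := ht.length_le
      rw [hs] at h1
      rw [← List.map_take, List.take_range, min_eq_left h2] at h1
      exact h1) (by
      rintro l ⟨f, hl⟩ hin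
      refine hsucc ((List.range l.length).map f) (hin.subset ?_)
      rintro _ ⟨k, rfl⟩
      refine ⟨Function.update f l.length k, ?_⟩
      have hup : ∀ n ≤ l.length, (List.range n).map (Function.update f l.length k) =
          (List.range n).map f := by
        intro n hn
        refine List.map_congr_left fun i hi => ?_
        have := List.mem_range.1 hi
        exact Function.update_of_ne (by omega) _ _
      rw [List.length_append, List.length_singleton, List.range_succ, List.map_append]
      congr 1
      · conv_lhs => rw [hl]
        refine List.map_congr_left fun i hi => ?_
        have := List.mem_range.1 hi
        exact (hup _ (by omega)).symm
      · simp [List.range_succ, hup])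
  have hpre : ∀ i j, i ≤ j → g i <+: g j := by
    intro i j hij
    obtain ⟨f, hf⟩ := hg (j + 1)
    simp only [List.length_map, List.length_range] at hf
    have h1 := List.map_inj_left.1 hf
    rw [h1 i (by simp; omega), h1 j (by simp)]
    obtain ⟨d, hd⟩ := Nat.exists_eq_add_of_le (Nat.succ_le_succ hij)
    rw [Nat.succ_eq_add_one, Nat.succ_eq_add_one] at hd
    rw [hd, List.range_add (n := i + 1), List.map_append]
    exact List.prefix_append _ _
  obtain ⟨f, hf⟩ := chain_subset_branch (C := range g) (by
    rintro _ ⟨i, rfl⟩ _ ⟨j, rfl⟩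
    exact (le_total i j).imp (hpre i j) (hpre j i))
  exact hpos ((inIdeal_of_mem (hbr f)).subset hf)

open Classical in
/-- A set almost disjoint from the branches and from `𝒟` that meets infinitely many `X n` in an
infinite set, if there is one. -/
noncomputable def stepSet (𝒟 : Set (Set (List ℕ))) (X : ℕ → Set (List ℕ)) : Set (List ℕ) :=
  if h : ∃ D : Set (List ℕ), D.Infinite ∧ (∀ A ∈ range branch ∪ 𝒟, (D ∩ A).Finite) ∧
      {n | (D ∩ X n).Infinite}.Infinite then h.choose else ∅

theorem stepSet_spec {𝒟 : Set (Set (List ℕ))} {X : ℕ → Set (List ℕ)}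
    (h : ∃ D : Set (List ℕ), D.Infinite ∧ (∀ A ∈ range branch ∪ 𝒟, (D ∩ A).Finite) ∧
      {n | (D ∩ X n).Infinite}.Infinite) :
    (stepSet 𝒟 X).Infinite ∧ (∀ A ∈ range branch ∪ 𝒟, (stepSet 𝒟 X ∩ A).Finite) ∧
      {n | (stepSet 𝒟 X ∩ X n).Infinite}.Infinite := by
  rw [stepSet, dif_pos h]
  exact h.choose_spec

theorem stepSet_inter_finite {𝒟 : Set (Set (List ℕ))} {X : ℕ → Set (List ℕ)}
    {A : Set (List ℕ)} (hA : A ∈ range branch ∪ 𝒟) : (stepSet 𝒟 X ∩ A).Finite := by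
  by_cases h : ∃ D : Set (List ℕ), D.Infinite ∧ (∀ A ∈ range branch ∪ 𝒟, (D ∩ A).Finite) ∧
      {n | (D ∩ X n).Infinite}.Infinite
  · exact (stepSet_spec h).2.1 A hA
  · rw [stepSet, dif_neg h]
    simp

theorem exists_linearOrder_countable_Iio {S : Type} (hS : Cardinal.mk S = Cardinal.aleph 1) :
    ∃ (_ : LinearOrder S) (_ : WellFoundedLT S), ∀ x : S, (Iio x).Countable := by
  obtain ⟨hlin, hwf, hord⟩ := Cardinal.exists_ord_eq_type_lt S
  refine ⟨hlin, hwf, fun x => ?_⟩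
  rw [← Cardinal.le_aleph0_iff_set_countable, ← Cardinal.lt_aleph_one_iff, ← hS]
  exact Cardinal.mk_Iio_lt x hord

/-- Under CH the sequences of subsets of `ω^{<ω}` can be enumerated in order type `ω₁`. -/
theorem exists_enumeration (hCH : Cardinal.continuum.{0} = Cardinal.aleph 1) :
    ∃ (ι : Type) (_ : LinearOrder ι) (_ : WellFoundedLT ι) (e : ι → ℕ → Set (List ℕ)),
      e.Surjective ∧ ∀ x : ι, (Iio x).Countable := by
  have key : ∀ S : Type, Cardinal.mk S = Cardinal.aleph 1 → ∀ e : S → ℕ → Set (List ℕ),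
      e.Surjective → ∃ (ι : Type) (_ : LinearOrder ι) (_ : WellFoundedLT ι)
        (e : ι → ℕ → Set (List ℕ)), e.Surjective ∧ ∀ x : ι, (Iio x).Countable := by
    intro S hS e he
    obtain ⟨h1, h2, h3⟩ := exists_linearOrder_countable_Iio hS
    exact ⟨S, h1, h2, e, he, h3⟩
  refine key (ℕ → Set (List ℕ)) ?_ id Function.surjective_id
  rw [← hCH]
  simp

/-- (CH) There is a weakly tight MAD family on `ω^{<ω}` that is not `+`-Ramsey. -/
theorem stmt17 (hCH : Cardinal.continuum = Cardinal.aleph 1) :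
    ∃ 𝒜 : Set (Set (List ℕ)), IsMAD 𝒜 ∧ WeaklyTight 𝒜 ∧ ¬ PlusRamsey 𝒜 := by
  obtain ⟨ι, _, _, e, he, hIio⟩ := exists_enumeration
    (Cardinal.lift_injective (by simpa using hCH))
  obtain ⟨E, hE⟩ : ∃ E : ι → Set (List ℕ), ∀ X, E X =
      stepSet (range succPiece ∪ {A | A.Infinite ∧ ∃ Y < X, E Y = A}) (e X) := by
    refine ⟨wellFounded_lt.fix fun X E => stepSet
      (range succPiece ∪ {A | A.Infinite ∧ ∃ (Y : _) (h : Y < X), E Y h = A}) (e X), fun X => ?_⟩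
    rw [WellFounded.fix_eq]
    simp only [exists_prop]
  have hEbr : ∀ X f, (E X ∩ branch f).Finite := fun X f => by
    rw [hE]; exact stepSet_inter_finite (Or.inl (mem_range_self f))
  have hEsucc : ∀ X p, (E X ∩ succPiece p).Finite := fun X p => by
    rw [hE]; exact stepSet_inter_finite (Or.inr (Or.inl (mem_range_self p)))
  have hElt : ∀ X Y, Y < X → (E X ∩ E Y).Finite := by
    intro X Y h
    by_cases hY : (E Y).Infinite
    · rw [hE X]; exact stepSet_inter_finite (Or.inr (Or.inr ⟨hY, Y, h, rfl⟩))
    · exact (not_infinite.1 hY).subset inter_subset_right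
  let 𝒜 : Set (Set (List ℕ)) :=
    range branch ∪ (range succPiece ∪ {A | A.Infinite ∧ ∃ X, E X = A})
  have hADF : IsADF 𝒜 := by
    constructor
    · rintro _ (⟨f, rfl⟩ | ⟨p, rfl⟩ | ⟨h, -⟩)
      exacts [branch_infinite f, succPiece_infinite p, h]
    · rintro _ (⟨f, rfl⟩ | ⟨p, rfl⟩ | ⟨-, X, rfl⟩) _ (⟨g, rfl⟩ | ⟨q, rfl⟩ | ⟨-, Y, rfl⟩) hne
      · exact branch_inter_branch_finite fun h => hne (congrArg branch h)
      · rw [inter_comm]; exact succPiece_inter_branch_finite q f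
      · rw [inter_comm]; exact hEbr Y f
      · exact succPiece_inter_branch_finite p g
      · rw [succPiece_disjoint fun h => hne (congrArg succPiece h)]; exact finite_empty
      · rw [inter_comm]; exact hEsucc Y p
      · exact hEbr X g
      · exact hEsucc X q
      · rcases lt_trichotomy X Y with h | h | h
        · rw [inter_comm]; exact hElt Y X h
        · exact absurd (congrArg E h) hne
        · exact hElt X Y h
  have hWT : WeaklyTight 𝒜 := by
    intro Z hX
    obtain ⟨X, rfl⟩ := he Z
    have hspec := stepSet_spec (exists_offBranch_set
      (𝒟 := range succPiece ∪ {A | A.Infinite ∧ ∃ Y < X, E Y = A})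
      ((countable_range _).union (((hIio X).image E).mono (by
        rintro _ ⟨-, Y, hY, rfl⟩
        exact ⟨Y, hY, rfl⟩)))
      (X := e X) fun n hn => hX n (hn.mono (union_subset_union_right _
        (union_subset_union_right _ (by
          rintro _ ⟨h, Y, -, rfl⟩
          exact ⟨h, Y, rfl⟩)))))
    rw [← hE X] at hspec
    exact ⟨E X, inIdeal_of_mem (Or.inr (Or.inr ⟨hspec.1, X, rfl⟩)), hspec.2.2⟩
  refine ⟨𝒜, hADF.isMAD_of_weaklyTight hWT, hWT,
    not_plusRamsey (fun f => Or.inl (mem_range_self f)) fun s => hADF.positive_of_infinite ?_⟩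
  have : (range fun k => succPiece (s, k)).Infinite :=
    infinite_range_of_injective fun k l h => (Prod.ext_iff.1 (succPiece_injective h)).2
  refine this.mono ?_
  rintro _ ⟨k, rfl⟩
  refine ⟨Or.inr (Or.inl (mem_range_self _)), ?_⟩
  rintro _ ⟨m, rfl⟩
  exact ⟨_, rfl⟩
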